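/- arXiv:2405.09998 — 5 statements merged into one kernel-verified Lean document; each statement's English description precedes it below -/
import Mathlib

section
/- Let R be a weakly finite unital ring. Then R is Hermite if and only if the following extension property holds: for every n ≥ 1, every k with k + 1 ≤ n - 1, and every linearly independent family v : Fin (k+1) → (Fin n → R) whose R-span is a direct summand of R^n, there exists a vector w ∈ R^n such that the extended family obtained from v by appending w is linearly independent and its R-span is a direct summand of R^n. -/
universe u v

/-- A ring is *Hermite* if every stably free left module is free. -/
def IsHermite (R : Type u) [Ring R] : Prop :=
  ∀ (M : Type u) [AddCommGroup M] [Module R M],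
    (∃ a b : ℕ, Nonempty ((M × (Fin a → R)) ≃ₗ[R] (Fin b → R))) → Module.Free R M

/-- A ring is *weakly finite* if `R^n ≅ R^n ⊕ C` implies `C = 0`. -/
def WeaklyFinite (R : Type u) [Ring R] : Prop :=
  ∀ (n : ℕ) (C : Type u) [AddCommGroup C] [Module R C],
    Nonempty (((Fin n → R) × C) ≃ₗ[R] (Fin n → R)) → Subsingleton C

/-- A submodule is a direct summand if it admits a complement. -/
def IsDirectSummand {R : Type u} [Ring R] {M : Type v} [AddCommGroup M] [Module R M]
    (V : Submodule R M) : Prop :=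
  ∃ C : Submodule R M, V ⊓ C = ⊥ ∧ V ⊔ C = ⊤

section Auxiliary

variable {R : Type u} [Ring R]

/-- Coordinates on `R^(m+d)` split into the first `m` and the last `d`. -/
def finAddLinearEquiv (R : Type u) [Ring R] (m d : ℕ) :
    (Fin (m + d) → R) ≃ₗ[R] (Fin m → R) × (Fin d → R) :=
  (LinearEquiv.funCongrLeft R R finSumFinEquiv).trans
    (LinearEquiv.sumArrowLequivProdArrow (Fin m) (Fin d) R R)

/-- Coordinates on `R^(m+1)` split into the last one and the first `m`. -/
def finSnocLinearEquiv (R : Type u) [Ring R] (m : ℕ) :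
    (Fin (m + 1) → R) ≃ₗ[R] R × (Fin m → R) where
  toFun x := (x (Fin.last m), fun i => x i.castSucc)
  invFun p := Fin.snoc p.2 p.1
  map_add' _ _ := rfl
  map_smul' _ _ := rfl
  left_inv x := by
    ext i
    refine Fin.lastCases ?_ (fun i => ?_) i <;> simp
  right_inv p := by simp

/-- A family is linearly independent with span a direct summand exactly when it is the image of
the standard basis of `R^m` under an isomorphism `C × R^m ≃ M`. -/
theorem linearIndependent_and_isDirectSummand_iff {M : Type u} [AddCommGroup M] [Module R M]
    {m : ℕ} (v : Fin m → M) :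
    LinearIndependent R v ∧ IsDirectSummand (Submodule.span R (Set.range v)) ↔
      ∃ (C : Type u) (_ : AddCommGroup C) (_ : Module R C) (e : (C × (Fin m → R)) ≃ₗ[R] M),
        ∀ x, e (0, x) = Fintype.linearCombination R v x := by
  constructor
  · rintro ⟨hv, C, hinf, hsup⟩
    have hC : IsCompl (Submodule.span R (Set.range v)) C :=
      ⟨disjoint_iff.2 hinf, codisjoint_iff.2 hsup⟩
    refine ⟨C, inferInstance, inferInstance,
      ((LinearEquiv.refl R C).prodCongr (Module.Basis.span hv).equivFun.symm).trans
        (Submodule.prodEquivOfIsCompl _ _ hC.symm), fun x => ?_⟩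
    simp [Module.Basis.equivFun_symm_apply, Fintype.linearCombination_apply,
      Module.Basis.span_apply]
  · rintro ⟨C, _, _, e, he⟩
    have hcomp : Fintype.linearCombination R v = e.toLinearMap ∘ₗ LinearMap.inr R C _ :=
      LinearMap.ext fun x => (he x).symm
    refine ⟨?_, LinearMap.range (e.toLinearMap ∘ₗ LinearMap.inl R C (Fin m → R)), ?_⟩
    · rw [linearIndependent_iff_injective_fintypeLinearCombination, hcomp]
      exact e.injective.comp LinearMap.inr_injective
    · rw [← Fintype.range_linearCombination, hcomp, LinearMap.range_comp, LinearMap.range_comp,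
        ← Submodule.map_inf _ e.injective, ← Submodule.map_sup, sup_comm, inf_comm,
        LinearMap.isCompl_range_inl_inr.inf_eq_bot, LinearMap.isCompl_range_inl_inr.sup_eq_top]
      simp

/-- An element on which a functional takes the value `1` splits off a free summand of rank one. -/
def kerProdLinearEquiv {C : Type v} [AddCommGroup C] [Module R C] (f : C →ₗ[R] R) (w : C)
    (h : f w = 1) : (LinearMap.ker f × R) ≃ₗ[R] C where
  toFun p := p.1 + p.2 • w
  invFun x := (⟨x - f x • w, by simp [h]⟩, f x)
  map_add' p q := by
    simp only [Prod.fst_add, Prod.snd_add, Submodule.coe_add, add_smul]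
    abel
  map_smul' r p := by simp [mul_smul]
  left_inv p := by
    have hp : f (p.1 : C) = 0 := p.1.2
    ext <;> simp [h, hp]
  right_inv x := by simp

theorem exists_functional_eq_one {C : Type v} [AddCommGroup C] [Module R C] [Module.Free R C]
    (h : Subsingleton C → Subsingleton R) : ∃ (f : C →ₗ[R] R) (w : C), f w = 1 := by
  classical
  obtain hC | hC := subsingleton_or_nontrivial C
  · have := h hC
    exact ⟨0, 0, Subsingleton.elim _ _⟩
  · let b := Module.Free.chooseBasis R C
    obtain ⟨i⟩ := b.index_nonempty
    exact ⟨b.coord i, b i, by simp⟩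

/-- The two maps between complements of a common factor are mutually inverse. -/
theorem fst_symm_apply_fst_symm_apply {M : Type*} {M' : Type*} {A : Type*} {N : Type*}
    [AddCommGroup M] [AddCommGroup M'] [AddCommGroup A] [AddCommGroup N]
    [Module R M] [Module R M'] [Module R A] [Module R N]
    (e : (M × A) ≃ₗ[R] N) (e' : (M' × A) ≃ₗ[R] N) (h : ∀ x, e (0, x) = e' (0, x)) (m : M) :
    (e.symm (e' ((e'.symm (e (m, 0))).1, 0))).1 = m := by
  obtain ⟨⟨m', x⟩, hp⟩ : ∃ p, e'.symm (e (m, 0)) = p := ⟨_, rfl⟩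
  have h1 : e' (m', 0) = e (m, -x) := by
    have h2 : e (m, 0) = e' (m', x) := by rw [← hp, LinearEquiv.apply_symm_apply]
    have h3 : e (m, -x) = e (m, 0) - e (0, x) := by rw [← map_sub]; simp
    rw [h3, h2, h, ← map_sub]
    simp
  rw [hp, h1]
  simp

/-- Two isomorphisms onto `N` that agree on the factor `A` induce an isomorphism of the
complementary factors. -/
def cancelLinearEquiv {M : Type*} {M' : Type*} {A : Type*} {N : Type*}
    [AddCommGroup M] [AddCommGroup M'] [AddCommGroup A] [AddCommGroup N]
    [Module R M] [Module R M'] [Module R A] [Module R N]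
    (e : (M × A) ≃ₗ[R] N) (e' : (M' × A) ≃ₗ[R] N) (h : ∀ x, e (0, x) = e' (0, x)) :
    M ≃ₗ[R] M' where
  __ := LinearMap.fst R M' A ∘ₗ (e.trans e'.symm).toLinearMap ∘ₗ LinearMap.inl R M A
  invFun m' := (e.symm (e' (m', 0))).1
  left_inv := fst_symm_apply_fst_symm_apply e e' h
  right_inv := fst_symm_apply_fst_symm_apply e' e fun x => (h x).symm

theorem WeaklyFinite.subsingleton (hWF : WeaklyFinite R) {C : Type u} [AddCommGroup C]
    [Module R C] {a b : ℕ} (hab : b ≤ a) (e : (C × (Fin a → R)) ≃ₗ[R] (Fin b → R)) :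
    Subsingleton C := by
  obtain ⟨d, rfl⟩ := Nat.exists_eq_add_of_le hab
  have : Subsingleton ((Fin d → R) × C) := hWF b _
    ⟨(LinearEquiv.prodAssoc R _ _ _).symm.trans <|
      ((finAddLinearEquiv R b d).symm.prodCongr (LinearEquiv.refl R C)).trans <|
      (LinearEquiv.prodComm R _ _).trans e⟩
  exact (Prod.snd_surjective (α := Fin d → R)).subsingleton

/-- Over a weakly finite Hermite ring, a basis of a proper-rank direct summand of `R^n` extends by
one vector. -/
theorem IsHermite.exists_extension (hWF : WeaklyFinite R) (hH : IsHermite R) {n m : ℕ}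
    (hm : m < n) {v : Fin m → (Fin n → R)} (hv : LinearIndependent R v)
    (hs : IsDirectSummand (Submodule.span R (Set.range v))) :
    ∃ w : Fin n → R, LinearIndependent R (Fin.snoc v w : Fin (m + 1) → (Fin n → R)) ∧
      IsDirectSummand
        (Submodule.span R (Set.range (Fin.snoc v w : Fin (m + 1) → (Fin n → R)))) := by
  obtain ⟨C, _, _, e, he⟩ := (linearIndependent_and_isDirectSummand_iff v).1 ⟨hv, hs⟩
  have : Module.Free R C := hH C ⟨m, n, ⟨e⟩⟩
  obtain ⟨f, w, hw⟩ : ∃ (f : C →ₗ[R] R) (w : C), f w = 1 := by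
    refine exists_functional_eq_one fun hC => ?_
    have : Unique C := ⟨⟨0⟩, fun _ => Subsingleton.elim _ _⟩
    obtain ⟨d, rfl⟩ := Nat.exists_eq_add_of_lt hm
    have : Subsingleton (Fin (d + 1) → R) := hWF.subsingleton le_rfl <|
      (LinearEquiv.prodComm R _ _).trans <| (finAddLinearEquiv R m (d + 1)).symm.trans <|
        e.symm.trans LinearEquiv.uniqueProd
    exact (LinearMap.proj_surjective (R := R) (φ := fun _ => R) (0 : Fin (d + 1))).subsingleton
  refine ⟨e (w, 0), (linearIndependent_and_isDirectSummand_iff _).2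
    ⟨LinearMap.ker f, inferInstance, inferInstance,
      ((LinearEquiv.refl R _).prodCongr (finSnocLinearEquiv R m)).trans <|
        (LinearEquiv.prodAssoc R _ _ _).symm.trans <|
        ((kerProdLinearEquiv f w hw).prodCongr (LinearEquiv.refl R _)).trans e, fun x => ?_⟩⟩
  have hx : e (x (Fin.last m) • w, fun i => x i.castSucc) =
      e (0, fun i => x i.castSucc) + x (Fin.last m) • e (w, 0) := by
    rw [← map_smul, ← map_add]
    simp
  have hsnoc : e ((0 : C) + x (Fin.last m) • w, fun i => x i.castSucc) =
      Fintype.linearCombination R (Fin.snoc v (e (w, 0)) : Fin (m + 1) → (Fin n → R)) x := by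
    simpa [Fintype.linearCombination_apply, Fin.sum_univ_castSucc, he] using hx
  exact hsnoc

/-- If families of positive size can be extended, then any complement of `R^a` in `R^b`, with
`a` positive, is free. -/
theorem free_of_forall_exists_extension (hWF : WeaklyFinite R)
    (hext : ∀ (n k : ℕ), 1 ≤ n → k + 1 ≤ n - 1 → ∀ v : Fin (k + 1) → (Fin n → R),
      LinearIndependent R v → IsDirectSummand (Submodule.span R (Set.range v)) →
      ∃ w : Fin n → R, LinearIndependent R (Fin.snoc v w : Fin (k + 2) → (Fin n → R)) ∧
        IsDirectSummand
          (Submodule.span R (Set.range (Fin.snoc v w : Fin (k + 2) → (Fin n → R)))))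
    (d : ℕ) : ∀ (k n : ℕ), n = k + 1 + d → ∀ (M : Type u) [AddCommGroup M] [Module R M],
      ((M × (Fin (k + 1) → R)) ≃ₗ[R] (Fin n → R)) → Module.Free R M := by
  classical
  induction d with
  | zero =>
    intro k n hn M _ _ e
    have := hWF.subsingleton hn.le e
    exact Module.Free.of_subsingleton R M
  | succ d ih =>
    intro k n hn M _ _ e
    let v : Fin (k + 1) → (Fin n → R) := fun i => e (0, Pi.single i 1)
    have hv : ∀ x, e (0, x) = Fintype.linearCombination R v x := by
      intro x
      have : e.toLinearMap ∘ₗ LinearMap.inr R M _ = Fintype.linearCombination R v := by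
        ext i j
        simp [v]
      exact LinearMap.congr_fun this x
    obtain ⟨hli, hds⟩ :=
      (linearIndependent_and_isDirectSummand_iff v).2 ⟨M, inferInstance, inferInstance, e, hv⟩
    obtain ⟨w, hw⟩ := hext n k (by omega) (by omega) v hli hds
    obtain ⟨C, _, _, e', he'⟩ := (linearIndependent_and_isDirectSummand_iff _).1 hw
    have : Module.Free R C := ih (k + 1) n (by omega) C e'
    refine Module.Free.of_equiv (cancelLinearEquiv e
      ((LinearEquiv.prodAssoc R C R (Fin (k + 1) → R)).trans <|
        ((LinearEquiv.refl R C).prodCongr (finSnocLinearEquiv R (k + 1)).symm).trans e')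
      fun x => ?_).symm
    simp [hv, he', finSnocLinearEquiv, Fintype.linearCombination_apply, Fin.sum_univ_castSucc]

end Auxiliary

/-- A weakly finite ring is Hermite iff every linearly independent family spanning a
direct summand of `R^n` of size at most `n - 1` can be extended by one vector to a
linearly independent family spanning a direct summand. -/
theorem hermite_iff_extension {R : Type u} [Ring R] (hWF : WeaklyFinite R) :
    IsHermite R ↔
      ∀ (n k : ℕ), 1 ≤ n → k + 1 ≤ n - 1 →
        ∀ v : Fin (k + 1) → (Fin n → R),
          LinearIndependent R v →
          IsDirectSummand (Submodule.span R (Set.range v)) →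
          ∃ w : Fin n → R,
            LinearIndependent R (Fin.snoc v w : Fin (k + 2) → (Fin n → R)) ∧
            IsDirectSummand
              (Submodule.span R (Set.range (Fin.snoc v w : Fin (k + 2) → (Fin n → R)))) := by
  refine ⟨fun hH n k _ hk v hv hs => hH.exists_extension hWF (by omega) hv hs,
    fun hext M _ _ ⟨a, b, ⟨e⟩⟩ => ?_⟩
  obtain hab | hab := le_total b a
  · have := hWF.subsingleton hab e
    exact Module.Free.of_subsingleton R M
  obtain _ | k := a
  · exact Module.Free.of_equiv (LinearEquiv.prodUnique.symm.trans e).symm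
  · obtain ⟨d, rfl⟩ := Nat.exists_eq_add_of_le hab
    exact free_of_forall_exists_extension hWF hext d k _ rfl M e
end

section
/- Let R be a Hermite unital ring and let V ≤ V' be submodules of R^n each of which is free as an R-module and a direct summand of R^n. Then V is a direct summand of V', i.e. there exists a submodule C of R^n with C ≤ V', V ⊓ C = ⊥ and V ⊔ C = V'; moreover the quotient module V'/V is a free R-module. -/
universe u v

/-- A direct summand of a finite module is finite. -/
theorem IsDirectSummand.finite {R : Type u} [Ring R] {M : Type v} [AddCommGroup M] [Module R M]
    [Module.Finite R M] {V : Submodule R M} (hV : IsDirectSummand V) : Module.Finite R V := by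
  obtain ⟨C, hinf, hsup⟩ := hV
  have h : IsCompl V C := ⟨disjoint_iff.mpr hinf, codisjoint_iff.mpr hsup⟩
  exact Module.Finite.of_surjective _
    (LinearMap.range_eq_top.mp (Submodule.range_projectionOnto h))

/-- A finite free module over any ring is isomorphic to `R^a` for some `a`. -/
theorem exists_linearEquiv_fin_of_free {R : Type u} [Ring R] (M : Type v) [AddCommGroup M]
    [Module R M] [Module.Finite R M] [Module.Free R M] :
    ∃ a : ℕ, Nonempty (M ≃ₗ[R] (Fin a → R)) := by
  let b := Module.Free.chooseBasis R M
  exact ⟨_, ⟨(b.reindex (Fintype.equivFin _)).equivFun⟩⟩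

/-- Over a Hermite ring, if `W` is a finite free submodule of a finite free module and `D` is a
complement of `W`, then the quotient by `W` is free. -/
theorem IsHermite.free_quotient {R : Type u} [Ring R] (hH : IsHermite R) {M : Type u}
    [AddCommGroup M] [Module R M] [Module.Finite R M] [Module.Free R M] {W D : Submodule R M}
    (h : IsCompl W D) [Module.Finite R W] [Module.Free R W] : Module.Free R (M ⧸ W) := by
  obtain ⟨a, ⟨e⟩⟩ := exists_linearEquiv_fin_of_free (R := R) W
  obtain ⟨b, ⟨f⟩⟩ := exists_linearEquiv_fin_of_free (R := R) M
  refine hH _ ⟨a, b, ⟨?_⟩⟩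
  exact ((Submodule.quotientEquivOfIsCompl W D h).prodCongr e.symm).trans
    ((Submodule.prodEquivOfIsCompl D W h.symm).trans f)

/-- Over a Hermite ring, if `V ≤ V'` are free direct summands of `R^n`, then `V` is a
direct summand of `V'` and `V'/V` is free. -/
theorem summand_in_summand {R : Type u} [Ring R] (hH : IsHermite R) {n : ℕ}
    (V V' : Submodule R (Fin n → R)) (hVV' : V ≤ V')
    (hVfree : Module.Free R V) (hV'free : Module.Free R V')
    (hV : IsDirectSummand V) (hV' : IsDirectSummand V') :
    (∃ C : Submodule R (Fin n → R), C ≤ V' ∧ V ⊓ C = ⊥ ∧ V ⊔ C = V') ∧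
    Module.Free R (V' ⧸ (V.comap V'.subtype)) := by
  have := hV.finite
  have := hV'.finite
  obtain ⟨C, hinf, hsup⟩ := hV
  have hsup' : V ⊔ C ⊓ V' = V' := by
    rw [← sup_inf_assoc_of_le C hVV', hsup, top_inf_eq]
  refine ⟨⟨C ⊓ V', inf_le_right, ?_, hsup'⟩, ?_⟩
  · rw [← inf_assoc, hinf, bot_inf_eq]
  · have e := Submodule.comapSubtypeEquivOfLe hVV'
    have : Module.Finite R (V.comap V'.subtype) := Module.Finite.equiv e.symm
    have : Module.Free R (V.comap V'.subtype) := Module.Free.of_equiv e.symm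
    refine hH.free_quotient (D := C.comap V'.subtype) ⟨?_, ?_⟩
    · rw [disjoint_iff, ← Submodule.comap_inf, hinf, Submodule.comap_bot, Submodule.ker_subtype]
    · rw [codisjoint_iff, eq_top_iff]
      rintro ⟨x, hx⟩ -
      obtain ⟨y, hy, z, hz, rfl⟩ := Submodule.mem_sup.mp (hsup'.ge hx)
      exact Submodule.mem_sup.mpr ⟨⟨y, hVV' hy⟩, hy, ⟨z, hz.2⟩, hz.1, rfl⟩
end

section
/- A unital ring R has the invariant basis number property and is Hermite if and only if its opposite ring R^op (MulOpposite R) has the invariant basis number property and is Hermite. -/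
universe u

/-- Invariant basis number property. -/
def HasIBN (R : Type u) [Ring R] : Prop :=
  ∀ m n : ℕ, Nonempty ((Fin m → R) ≃ₗ[R] (Fin n → R)) → m = n

theorem hasIBN_iff_invariantBasisNumber (R : Type u) [Ring R] :
    HasIBN R ↔ InvariantBasisNumber R :=
  ⟨fun h => ⟨fun e => h _ _ ⟨e⟩⟩, fun _ _ _ ⟨e⟩ => eq_of_fin_equiv R e⟩

/-- Every right-invertible rectangular matrix can be completed to an invertible block matrix,
together with its inverse. -/
def HasUnimodularCompletion (R : Type u) [Ring R] : Prop :=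
  ∀ (a b : ℕ) (A : Matrix (Fin a) (Fin b) R) (B : Matrix (Fin b) (Fin a) R), A * B = 1 →
    ∃ (c : ℕ) (C : Matrix (Fin c) (Fin b) R) (D : Matrix (Fin b) (Fin c) R),
      A * D = 0 ∧ C * B = 0 ∧ C * D = 1 ∧ B * A + D * C = 1

theorem IsHermite.hasUnimodularCompletion {R : Type u} [Ring R] (hR : IsHermite R) :
    HasUnimodularCompletion R := by
  intro a b A B hAB
  let f := Matrix.toLinearMapRight' A
  let g := Matrix.toLinearMapRight' B
  have hgf : ∀ v, g (f v) = v := fun v => by simp [f, g, Matrix.vecMul_vecMul, hAB]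
  let p : (Fin b → R) →ₗ[R] LinearMap.ker g :=
    (LinearMap.id - f ∘ₗ g).codRestrict _ fun w => by simp [hgf]
  have hp : ∀ w, (p w : Fin b → R) = w - f (g w) := fun w => rfl
  have hpm : ∀ m : LinearMap.ker g, p m = m := fun m => by
    ext1
    rw [hp, LinearMap.mem_ker.1 m.2, map_zero, sub_zero]
  have hpf : ∀ v, p (f v) = 0 := fun v => by
    ext1
    rw [hp, hgf, sub_self, Submodule.coe_zero]
  let e : (LinearMap.ker g × (Fin a → R)) ≃ₗ[R] (Fin b → R) :=
    LinearEquiv.ofLinearMap ((LinearMap.ker g).subtype.coprod f) (p.prod g)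
      (LinearMap.ext fun w => by simp [hp])
      (LinearMap.ext fun x => by
        have := LinearMap.mem_ker.1 x.1.2
        ext1 <;> simp [hpm, hpf, hgf])
  have : Module.Free R (LinearMap.ker g) := hR _ ⟨a, b, ⟨e⟩⟩
  have : Module.Finite R (LinearMap.ker g) :=
    Module.Finite.of_surjective p fun m => ⟨m, hpm m⟩
  let φ : LinearMap.ker g ≃ₗ[R] (Fin (Fintype.card (Module.Free.ChooseBasisIndex R _)) → R) :=
    ((Module.Free.chooseBasis R (LinearMap.ker g)).reindex (Fintype.equivFin _)).equivFun
  let h := (LinearMap.ker g).subtype ∘ₗ φ.symm.toLinearMap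
  let k := φ.toLinearMap ∘ₗ p
  refine ⟨_, LinearMap.toMatrixRight' h, LinearMap.toMatrixRight' k, ?_, ?_, ?_, ?_⟩ <;>
    apply Matrix.toLinearMapRight'.injective <;> apply LinearMap.ext <;> intro v
  · simpa [Matrix.toLinearMapRight'_mul, k, f] using hpf v
  · simpa [Matrix.toLinearMapRight'_mul, h, g, -LinearMap.map_coe_ker] using
      LinearMap.mem_ker.1 (φ.symm v).2
  · simp [Matrix.toLinearMapRight'_mul, h, k, hpm]
  · have : f (g v) + p v = v := by simp [hp]
    simpa [Matrix.toLinearMapRight'_mul, h, k, f, g] using this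

theorem HasUnimodularCompletion.isHermite {R : Type u} [Ring R]
    (hR : HasUnimodularCompletion R) : IsHermite R := by
  rintro M _ _ ⟨a, b, ⟨e⟩⟩
  let f : (Fin a → R) →ₗ[R] (Fin b → R) := e.toLinearMap ∘ₗ LinearMap.inr R M _
  let g : (Fin b → R) →ₗ[R] (Fin a → R) := LinearMap.snd R M _ ∘ₗ e.symm.toLinearMap
  obtain ⟨c, C, D, -, hCB, hCD, hsum⟩ := hR a b (LinearMap.toMatrixRight' f)
    (LinearMap.toMatrixRight' g) (by
      apply Matrix.toLinearMapRight'.injective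
      refine LinearMap.ext fun v => ?_
      simp [Matrix.toLinearMapRight'_mul, f, g])
  let h := Matrix.toLinearMapRight' C
  let k := Matrix.toLinearMapRight' D
  have hgh : ∀ v, (e.symm (h v)).2 = 0 := fun v => by
    simpa [Matrix.toLinearMapRight'_mul, g, h] using
      LinearMap.congr_fun (congrArg Matrix.toLinearMapRight' hCB) v
  have hkh : ∀ v, k (h v) = v := fun v => by simp [h, k, Matrix.vecMul_vecMul, hCD]
  have hfg : ∀ w, e (0, (e.symm w).2) + h (k w) = w := fun w => by
    simpa [Matrix.toLinearMapRight'_mul, f, g, h, k] using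
      LinearMap.congr_fun (congrArg Matrix.toLinearMapRight' hsum) w
  refine Module.Free.of_equiv (LinearEquiv.ofLinearMap
    (LinearMap.fst R M _ ∘ₗ e.symm.toLinearMap ∘ₗ h)
    (k ∘ₗ e.toLinearMap ∘ₗ LinearMap.inl R M _)
    (LinearMap.ext fun m => ?_) (LinearMap.ext fun v => ?_))
  · have := hfg (e (m, 0))
    rw [e.symm_apply_apply, Prod.mk_zero_zero, map_zero, zero_add] at this
    simp [this]
  · have : ((e.symm (h v)).1, (0 : Fin a → R)) = e.symm (h v) := Prod.ext rfl (hgh v).symm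
    simp [this, hkh]

theorem isHermite_iff_hasUnimodularCompletion (R : Type u) [Ring R] :
    IsHermite R ↔ HasUnimodularCompletion R :=
  ⟨IsHermite.hasUnimodularCompletion, HasUnimodularCompletion.isHermite⟩

namespace Matrix

variable {R S l m n : Type*} [Ring R] [Ring S]

/-- The transpose of a matrix, with an anti-homomorphism applied to its entries. -/
def antiTranspose (f : R →+* Sᵐᵒᵖ) (A : Matrix m n R) : Matrix n m S :=
  of fun i j => (f (A j i)).unop

theorem antiTranspose_mul [Fintype m] (f : R →+* Sᵐᵒᵖ) (A : Matrix l m R) (B : Matrix m n R) :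
    antiTranspose f (A * B) = antiTranspose f B * antiTranspose f A := by
  ext i j
  simp [antiTranspose, mul_apply]

theorem antiTranspose_add (f : R →+* Sᵐᵒᵖ) (A B : Matrix m n R) :
    antiTranspose f (A + B) = antiTranspose f A + antiTranspose f B := by
  ext i j
  simp [antiTranspose]

theorem antiTranspose_zero (f : R →+* Sᵐᵒᵖ) :
    antiTranspose f (0 : Matrix m n R) = 0 := by
  ext i j
  simp [antiTranspose]

theorem antiTranspose_one [DecidableEq n] (f : R →+* Sᵐᵒᵖ) :
    antiTranspose f (1 : Matrix n n R) = 1 := by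
  ext i j
  obtain rfl | hij := eq_or_ne i j
  · simp [antiTranspose]
  · simp [antiTranspose, hij, hij.symm]

end Matrix

open Matrix in
/-- Unimodular completion passes across an anti-isomorphism of rings, by transposing matrices. -/
theorem HasUnimodularCompletion.of_antiEquiv {R S : Type u} [Ring R] [Ring S]
    (e : R ≃+* Sᵐᵒᵖ) (hR : HasUnimodularCompletion R) : HasUnimodularCompletion S := by
  intro a b A B hAB
  let σ : S →+* Rᵐᵒᵖ := ((RingEquiv.opOp S).trans (RingEquiv.op e.symm)).toRingHom
  let τ : R →+* Sᵐᵒᵖ := e.toRingHom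
  have hτσ : ∀ {k l : ℕ} (X : Matrix (Fin k) (Fin l) S),
      antiTranspose τ (antiTranspose σ X) = X := fun X => by
    ext i j
    simp [antiTranspose, σ, τ]
  obtain ⟨c, C, D, h₁, h₂, h₃, h₄⟩ := hR a b (antiTranspose σ B) (antiTranspose σ A) (by
    rw [← antiTranspose_mul, hAB, antiTranspose_one])
  refine ⟨c, antiTranspose τ D, antiTranspose τ C, ?_, ?_, ?_, ?_⟩
  · simpa only [antiTranspose_mul, antiTranspose_zero, hτσ] using congrArg (antiTranspose τ) h₂
  · simpa only [antiTranspose_mul, antiTranspose_zero, hτσ] using congrArg (antiTranspose τ) h₁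
  · simpa only [antiTranspose_mul, antiTranspose_one] using congrArg (antiTranspose τ) h₃
  · simpa only [antiTranspose_add, antiTranspose_mul, antiTranspose_one, hτσ] using
      congrArg (antiTranspose τ) h₄

/-- A ring has IBN and is Hermite iff its opposite ring does. -/
theorem ibn_hermite_iff_op (R : Type u) [Ring R] :
    (HasIBN R ∧ IsHermite R) ↔ (HasIBN Rᵐᵒᵖ ∧ IsHermite Rᵐᵒᵖ) := by
  simp only [hasIBN_iff_invariantBasisNumber, isHermite_iff_hasUnimodularCompletion]
  exact and_congr MulOpposite.invariantBasisNumber_iff.symm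
    ⟨.of_antiEquiv (RingEquiv.opOp R), .of_antiEquiv (RingEquiv.refl _)⟩
end

section
/- Let R be a Hermite unital ring with the invariant basis number property and let V ∈ 𝕋(R^n). Then the map U ↦ (image of U under the quotient map q : R^n → R^n / V) is an order isomorphism from the subposet {U ∈ 𝕋(R^n) : V < U} onto the Tits poset 𝕋(R^n / V) of the free R-module R^n / V, with inverse given by W ↦ q⁻¹(W) (the comap of W along q). -/
universe u v

/-- The annihilator `V°` of a submodule `V ≤ M` inside the dual `M^∨ = Hom_R(M,R)`,
as an `Rᵐᵒᵖ`-submodule. -/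
def polarSubmodule {R : Type u} [Ring R] {M : Type v} [AddCommGroup M] [Module R M]
    (V : Submodule R M) : Submodule Rᵐᵒᵖ (M →ₗ[R] R) where
  carrier := {f | ∀ v ∈ V, f v = 0}
  add_mem' := by
    intro f g hf hg x hx
    simp [hf x hx, hg x hx]
  zero_mem' := by intro x hx; rfl
  smul_mem' := by
    intro r f hf x hx
    simp [LinearMap.smul_apply, hf x hx]

/-- The Tits poset of a free module: nonzero proper free direct summands. -/
def titsSet (R : Type u) [Ring R] (M : Type v) [AddCommGroup M] [Module R M] :
    Set (Submodule R M) :=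
  {V | V ≠ ⊥ ∧ V ≠ ⊤ ∧ Module.Free R V ∧ IsDirectSummand V}

theorem isDirectSummand_iff_exists_isCompl {R : Type u} [Ring R] {M : Type v} [AddCommGroup M]
    [Module R M] {V : Submodule R M} : IsDirectSummand V ↔ ∃ C, IsCompl V C := by
  simp only [IsDirectSummand, isCompl_iff, disjoint_iff, codisjoint_iff]

/-- A submodule `U` containing a direct summand `V` is the product of `V` and `U / V`. -/
theorem nonempty_equiv_prod_map_mkQ {R : Type u} [Ring R] {M : Type v} [AddCommGroup M]
    [Module R M] {V D U : Submodule R M} (hD : IsCompl V D) (hVU : V ≤ U) :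
    Nonempty (U ≃ₗ[R] (U.map V.mkQ) × V) := by
  let p := V.projectionOnto D hD
  let q : U →ₗ[R] U.map V.mkQ :=
    V.mkQ.restrict fun x hx => Submodule.mem_map_of_mem hx
  refine ⟨LinearEquiv.ofBijective (q.prod (p ∘ₗ U.subtype)) ⟨?_, ?_⟩⟩
  · rw [← LinearMap.ker_eq_bot, LinearMap.ker_eq_bot']
    rintro ⟨x, hx⟩ h
    have hq : V.mkQ x = 0 := congrArg (fun y => (y.1 : M ⧸ V)) h
    have hp : p x = 0 := congrArg Prod.snd h
    have hxV : x ∈ V := by simpa using hq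
    have hxD : x ∈ D :=
      (Submodule.projectionOnto_apply_eq_zero_iff hD).mp hp
    exact Subtype.ext (Submodule.disjoint_def.mp hD.disjoint x hxV hxD)
  · rintro ⟨⟨_, u, hu, rfl⟩, v⟩
    refine ⟨⟨u - p u + v, add_mem (sub_mem hu (hVU (p u).2)) (hVU v.2)⟩, Prod.ext ?_ ?_⟩
    · apply Subtype.ext
      change V.mkQ (u - p u + v) = V.mkQ u
      rw [← sub_eq_zero, ← map_sub, Submodule.mkQ_apply, Submodule.Quotient.mk_eq_zero]
      have : u - p u + v - u = v - p u := by abel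
      rw [this]
      exact sub_mem v.2 (p u).2
    · change p (u - p u + v) = v
      simp only [map_add, map_sub, p, Submodule.projectionOnto_apply_left, sub_self, zero_add]

/-- A free direct summand of `R^n` is isomorphic to some `R^a`. -/
theorem exists_equiv_fin_of_isDirectSummand {R : Type u} [Ring R] {n : ℕ}
    {V : Submodule R (Fin n → R)} [Module.Free R V] (hV : IsDirectSummand V) :
    ∃ a : ℕ, Nonempty (V ≃ₗ[R] (Fin a → R)) := by
  obtain ⟨D, hD⟩ := isDirectSummand_iff_exists_isCompl.mp hV
  have : Module.Finite R V := Module.Finite.of_surjective (V.projectionOnto D hD)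
    (Submodule.projectionOnto_surjective hD)
  exact ⟨_, ⟨(Module.Free.chooseBasis R V).equivFun.trans
    (LinearEquiv.funCongrLeft R R (Fintype.equivFin _).symm)⟩⟩

theorem map_mkQ_mem_titsSet {R : Type u} [Ring R] (hH : IsHermite R) {n : ℕ}
    {V U : Submodule R (Fin n → R)} (hV : V ∈ titsSet R (Fin n → R))
    (hU : U ∈ titsSet R (Fin n → R)) (hVU : V < U) :
    U.map V.mkQ ∈ titsSet R ((Fin n → R) ⧸ V) := by
  obtain ⟨-, -, hVfree, hVs⟩ := hV
  obtain ⟨-, hUtop, hUfree, hUs⟩ := hU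
  have hcomap : (U.map V.mkQ).comap V.mkQ = U := by
    rw [Submodule.comap_map_mkQ, sup_eq_right.mpr hVU.le]
  refine ⟨fun h => ?_, fun h => ?_, ?_, ?_⟩
  · rw [h, Submodule.comap_bot, Submodule.ker_mkQ] at hcomap
    exact hVU.ne hcomap
  · rw [h, Submodule.comap_top] at hcomap
    exact hUtop hcomap.symm
  · obtain ⟨a, ⟨ea⟩⟩ := exists_equiv_fin_of_isDirectSummand hVs
    obtain ⟨b, ⟨eb⟩⟩ := exists_equiv_fin_of_isDirectSummand hUs
    obtain ⟨D, hD⟩ := isDirectSummand_iff_exists_isCompl.mp hVs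
    obtain ⟨e⟩ := nonempty_equiv_prod_map_mkQ hD hVU.le
    exact hH _ ⟨a, b, ⟨((LinearEquiv.refl R _).prodCongr ea.symm).trans (e.symm.trans eb)⟩⟩
  · obtain ⟨C, hC, hC'⟩ := hUs
    refine ⟨C.map V.mkQ, ?_, ?_⟩
    · apply Submodule.comap_injective_of_surjective V.mkQ_surjective
      rw [Submodule.comap_inf, hcomap, Submodule.comap_map_mkQ, Submodule.comap_bot,
        Submodule.ker_mkQ, inf_comm, sup_inf_assoc_of_le C hVU.le, inf_comm, hC, sup_bot_eq]
    · rw [← Submodule.map_sup, hC', Submodule.map_top, Submodule.range_mkQ]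

theorem comap_mkQ_mem_titsSet {R : Type u} [Ring R] {M : Type v} [AddCommGroup M] [Module R M]
    {V : Submodule R M} (hV : V ∈ titsSet R M) {W : Submodule R (M ⧸ V)}
    (hW : W ∈ titsSet R (M ⧸ V)) : W.comap V.mkQ ∈ titsSet R M ∧ V < W.comap V.mkQ := by
  obtain ⟨hVbot, -, hVfree, hVs⟩ := hV
  obtain ⟨hWbot, hWtop, hWfree, C, hC, hC'⟩ := hW
  obtain ⟨D, hD⟩ := isDirectSummand_iff_exists_isCompl.mp hVs
  have hmap (X : Submodule R (M ⧸ V)) : (X.comap V.mkQ).map V.mkQ = X :=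
    Submodule.map_comap_eq_of_surjective V.mkQ_surjective X
  have hle (X : Submodule R (M ⧸ V)) : V ≤ X.comap V.mkQ := Submodule.le_comap_mkQ V X
  have hlt : V < W.comap V.mkQ := by
    refine (hle W).lt_of_ne fun h => hWbot ?_
    rw [← hmap W, ← h, Submodule.mkQ_map_self]
  refine ⟨⟨fun h => hVbot (le_bot_iff.mp (h ▸ hle W)), fun h => hWtop ?_, ?_, ?_⟩, hlt⟩
  · rw [← hmap W, h, Submodule.map_top, Submodule.range_mkQ]
  · obtain ⟨e⟩ := nonempty_equiv_prod_map_mkQ hD (hle W)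
    rw [hmap W] at e
    exact Module.Free.of_equiv e.symm
  · refine ⟨C.comap V.mkQ ⊓ D, ?_, ?_⟩
    · rw [← inf_assoc, ← Submodule.comap_inf, hC, Submodule.comap_bot, Submodule.ker_mkQ,
        hD.inf_eq_bot]
    · have hCD : V ⊔ (C.comap V.mkQ ⊓ D) = C.comap V.mkQ := by
        rw [inf_comm, ← sup_inf_assoc_of_le D (hle C), hD.sup_eq_top, top_inf_eq]
      have hsup : W.comap V.mkQ ⊔ C.comap V.mkQ = ⊤ := by
        rw [← sup_eq_right.mpr ((hle W).trans le_sup_left), ← Submodule.comap_map_mkQ,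
          Submodule.map_sup, hmap, hmap, hC', Submodule.comap_top]
      rw [← sup_eq_left.mpr (hle W), sup_assoc, hCD, hsup]

/-- Over a Hermite ring with IBN, for `V` in the Tits poset of `R^n`, the quotient map
induces an order isomorphism between `{U ∈ 𝕋(R^n) : V < U}` and `𝕋(R^n / V)`. -/
theorem tits_upper_fiber {R : Type u} [Ring R] (hH : IsHermite R) (hIBN : HasIBN R)
    {n : ℕ} (V : Submodule R (Fin n → R)) (hV : V ∈ titsSet R (Fin n → R)) :
    ∃ e : {U : Submodule R (Fin n → R) // U ∈ titsSet R (Fin n → R) ∧ V < U} ≃o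
          {W : Submodule R ((Fin n → R) ⧸ V) // W ∈ titsSet R ((Fin n → R) ⧸ V)},
      (∀ U, (e U : Submodule R ((Fin n → R) ⧸ V)) =
        (U : Submodule R (Fin n → R)).map V.mkQ) ∧
      (∀ W, (e.symm W : Submodule R (Fin n → R)) =
        (W : Submodule R ((Fin n → R) ⧸ V)).comap V.mkQ) := by
  have hcomap {U : Submodule R (Fin n → R)} (h : V < U) : (U.map V.mkQ).comap V.mkQ = U := by
    rw [Submodule.comap_map_mkQ, sup_eq_right.mpr h.le]
  refine ⟨{ toFun := fun U => ⟨U.1.map V.mkQ, map_mkQ_mem_titsSet hH hV U.2.1 U.2.2⟩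
            invFun := fun W => ⟨W.1.comap V.mkQ, comap_mkQ_mem_titsSet hV W.2⟩
            left_inv := fun U => Subtype.ext (hcomap U.2.2)
            right_inv := fun W => Subtype.ext
              (Submodule.map_comap_eq_of_surjective V.mkQ_surjective W.1)
            map_rel_iff' := ?_ }, fun _ => rfl, fun _ => rfl⟩
  intro U U'
  refine ⟨fun h => ?_, fun h => Submodule.map_mono h⟩
  have h' : U.1.map V.mkQ ≤ U'.1.map V.mkQ := h
  rw [Submodule.map_le_iff_le_comap, hcomap U'.2.2] at h'
  exact h'
end

section
/- Let R be a Hermite unital ring and let V ∈ 𝕋(R^n). Then for every submodule U of R^n with ⊥ ≠ U and U < V, one has U ∈ 𝕋(R^n) if and only if U is free as an R-module and is a direct summand of V. Consequently the identity on submodules induces an order isomorphism from the subposet {U ∈ 𝕋(R^n) : U < V} onto the Tits poset 𝕋(V) of the free R-module V. -/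
universe u v

theorem Submodule.comap_subtype_eq_bot_iff {R : Type u} [Ring R] {M : Type v} [AddCommGroup M]
    [Module R M] {U V : Submodule R M} (hUV : U ≤ V) :
    U.comap V.subtype = ⊥ ↔ U = ⊥ := by
  rw [← Submodule.disjoint_iff_comap_eq_bot, disjoint_iff, inf_eq_right.2 hUV]

/-- Summands of a direct summand `V` are the ambient direct summands contained in `V`. -/
theorem isDirectSummand_iff_exists_le {R : Type u} [Ring R] {M : Type v} [AddCommGroup M]
    [Module R M] {U V : Submodule R M} (hUV : U ≤ V) (hV : IsDirectSummand V) :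
    IsDirectSummand U ↔ ∃ C : Submodule R M, C ≤ V ∧ U ⊓ C = ⊥ ∧ U ⊔ C = V := by
  constructor
  · rintro ⟨C, hinf, hsup⟩
    refine ⟨C ⊓ V, inf_le_right, ?_, ?_⟩
    · rw [← inf_assoc, hinf, bot_inf_eq]
    · rw [← sup_inf_assoc_of_le C hUV, hsup, top_inf_eq]
  · rintro ⟨C, -, hinf, hsup⟩
    obtain ⟨D, hD, hD'⟩ := hV
    refine ⟨C ⊔ D, ?_, by rw [← sup_assoc, hsup, hD']⟩
    rw [← disjoint_iff] at hinf hD ⊢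
    rw [← hsup] at hD
    exact hinf.disjoint_sup_right_of_disjoint_sup_left hD

theorem isDirectSummand_comap_subtype_iff {R : Type u} [Ring R] {M : Type v} [AddCommGroup M]
    [Module R M] {U V : Submodule R M} (hUV : U ≤ V) :
    IsDirectSummand (U.comap V.subtype) ↔
      ∃ C : Submodule R M, C ≤ V ∧ U ⊓ C = ⊥ ∧ U ⊔ C = V := by
  have hmap : (U.comap V.subtype).map V.subtype = U := by
    rw [Submodule.map_comap_subtype, inf_eq_right.2 hUV]
  constructor
  · rintro ⟨C, hinf, hsup⟩
    refine ⟨C.map V.subtype, Submodule.map_subtype_le V C, ?_, ?_⟩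
    · rw [← hmap, ← Submodule.map_inf _ V.injective_subtype, hinf, Submodule.map_bot]
    · rw [← hmap, ← Submodule.map_sup, hsup, Submodule.map_subtype_top]
  · rintro ⟨C, hCV, hinf, hsup⟩
    refine ⟨C.comap V.subtype, ?_, ?_⟩
    · rw [← Submodule.comap_inf, Submodule.comap_subtype_eq_bot_iff (inf_le_left.trans hUV), hinf]
    · apply Submodule.map_injective_of_injective V.injective_subtype
      rw [Submodule.map_sup, hmap, Submodule.map_comap_subtype, inf_eq_right.2 hCV, hsup,
        Submodule.map_subtype_top]

theorem comap_subtype_mem_titsSet_iff {R : Type u} [Ring R] {M : Type v} [AddCommGroup M]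
    [Module R M] {U V : Submodule R M} (hUV : U ≤ V) (hV : V ∈ titsSet R M) :
    U.comap V.subtype ∈ titsSet R V ↔ U ∈ titsSet R M ∧ U < V := by
  obtain ⟨-, hVtop, -, hVs⟩ := hV
  have hfree : Module.Free R (U.comap V.subtype) ↔ Module.Free R U :=
    Module.Free.iff_of_equiv (Submodule.comapSubtypeEquivOfLe hUV)
  have hlt : U < V ↔ ¬ V ≤ U := ⟨not_le_of_gt, lt_of_le_not_ge hUV⟩
  have htop : ¬ V ≤ U → U ≠ ⊤ := fun h hU => h (hU ▸ le_top)
  simp only [titsSet, Set.mem_ofPred_eq, ne_eq, Submodule.comap_subtype_eq_bot_iff hUV,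
    Submodule.comap_subtype_eq_top, isDirectSummand_comap_subtype_iff hUV, hfree,
    isDirectSummand_iff_exists_le hUV hVs, hlt]
  tauto

/-- The order isomorphism from the part of the Tits poset strictly below `V` to the Tits poset
of `V`, given by restricting submodules to `V`. -/
def titsSetLowerFiberEquiv {R : Type u} [Ring R] {M : Type v} [AddCommGroup M] [Module R M]
    (V : Submodule R M) (hV : V ∈ titsSet R M) :
    {U : Submodule R M // U ∈ titsSet R M ∧ U < V} ≃o {W : Submodule R V // W ∈ titsSet R V} where
  toFun U := ⟨U.1.comap V.subtype, (comap_subtype_mem_titsSet_iff U.2.2.le hV).2 U.2⟩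
  invFun W := ⟨W.1.map V.subtype, by
    rw [← comap_subtype_mem_titsSet_iff (Submodule.map_subtype_le V W.1) hV,
      Submodule.comap_map_eq_of_injective V.injective_subtype]
    exact W.2⟩
  left_inv U := Subtype.ext <| by
    simp [Submodule.map_comap_subtype, U.2.2.le]
  right_inv W := Subtype.ext <|
    Submodule.comap_map_eq_of_injective V.injective_subtype W.1
  map_rel_iff' {U U'} := by
    change U.1.comap V.subtype ≤ U'.1.comap V.subtype ↔ U.1 ≤ U'.1
    rw [← Submodule.map_le_iff_le_comap, Submodule.map_comap_subtype, inf_eq_right.2 U.2.2.le]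

/-- Over a Hermite ring, for `V` in the Tits poset of `R^n`: a nonzero submodule `U < V`
belongs to `𝕋(R^n)` iff it is free and a direct summand of `V`; consequently the identity
induces an order isomorphism `{U ∈ 𝕋(R^n) : U < V} ≅ 𝕋(V)`. -/
theorem tits_lower_fiber {R : Type u} [Ring R] (hH : IsHermite R)
    {n : ℕ} (V : Submodule R (Fin n → R)) (hV : V ∈ titsSet R (Fin n → R)) :
    (∀ U : Submodule R (Fin n → R), U ≠ ⊥ → U < V →
      (U ∈ titsSet R (Fin n → R) ↔
        (Module.Free R U ∧
          ∃ C : Submodule R (Fin n → R), C ≤ V ∧ U ⊓ C = ⊥ ∧ U ⊔ C = V))) ∧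
    ∃ e : {U : Submodule R (Fin n → R) // U ∈ titsSet R (Fin n → R) ∧ U < V} ≃o
          {W : Submodule R V // W ∈ titsSet R V},
      ∀ U, (e U : Submodule R V) =
        (U : Submodule R (Fin n → R)).comap V.subtype := by
  refine ⟨fun U hU hUV => ?_, titsSetLowerFiberEquiv V hV, fun _ => rfl⟩
  rw [← isDirectSummand_iff_exists_le hUV.le hV.2.2.2]
  exact ⟨fun h => h.2.2, fun h => ⟨hU, (hUV.trans_le le_top).ne, h⟩⟩
end
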